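/- For every i ≥ 0 and all integers t, r, s with 0 ≤ t < a_{2i+2}, 0 ≤ r < k_{2i+1}, 0 ≤ s < h_{2i+1}, one has p₁^{r}·p₂^{h_{2i}+t·h_{2i+1}+s} < p₁^{r+k_{2i}+t·k_{2i+1}}·p₂^{s}, and there is no element of S strictly between these two numbers; that is, p₁^{r+k_{2i}+t·k_{2i+1}}·p₂^{s} is the immediate successor of p₁^{r}·p₂^{h_{2i}+t·h_{2i+1}+s} in S. -/

import Mathlib

theorem pow_mul_pow_lt_iff_log_ratio {p q : ℕ} (hp : 1 < p) (hq : 1 < q) (r u b c : ℕ) :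
    p ^ r * q ^ u < p ^ b * q ^ c ↔
      (r : ℝ) * (Real.log p / Real.log q) + u < b * (Real.log p / Real.log q) + c := by
  have hp0 : (0 : ℝ) < p := by exact_mod_cast (by omega : 0 < p)
  have hq0 : (0 : ℝ) < q := by exact_mod_cast (by omega : 0 < q)
  have hlq : 0 < Real.log q := Real.log_pos (by exact_mod_cast hq)
  have key (x y : ℕ) : Real.log ((p : ℝ) ^ x * (q : ℝ) ^ y) =
      (x * (Real.log p / Real.log q) + y) * Real.log q := by
    rw [Real.log_mul (by positivity) (by positivity), Real.log_pow, Real.log_pow]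
    field_simp
  rw [← Nat.cast_lt (α := ℝ)]
  push_cast
  rw [← Real.log_lt_log_iff (by positivity) (by positivity), key, key, mul_lt_mul_iff_left₀ hlq]

/-- All the complete quotients in a continued fraction expansion of a positive irrational number
are positive and irrational. -/
theorem irrational_and_pos_of_gauss_map {a : ℕ → ℕ} {β : ℕ → ℝ} (hirr : Irrational (β 0))
    (hpos : 0 < β 0) (hfloor : ∀ i, (a (i + 1) : ℤ) = ⌊1 / β i⌋)
    (hβrec : ∀ i, β (i + 1) = 1 / β i - (a (i + 1) : ℝ)) (n : ℕ) :
    Irrational (β n) ∧ 0 < β n := by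
  induction n with
  | zero => exact ⟨hirr, hpos⟩
  | succ n ih =>
    have h1 : Irrational (β (n + 1)) := by
      rw [hβrec, one_div]
      exact (irrational_inv_iff.mpr ih.1).sub_natCast _
    refine ⟨h1, lt_of_le_of_ne ?_ h1.ne_zero.symm⟩
    have h2 : ((a (n + 1) : ℤ) : ℝ) ≤ 1 / β n := by
      rw [hfloor n]
      exact Int.floor_le _
    rw [hβrec]
    push_cast at h2
    linarith

theorem convergent_error_succ {a h k : ℕ → ℕ} {β : ℕ → ℝ} (hβ : ∀ n, β n ≠ 0)
    (hβrec : ∀ i, β (i + 1) = 1 / β i - (a (i + 1) : ℝ))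
    (hh0 : h 0 = 0) (hk0 : k 0 = 1) (hh1 : h 1 = 1) (hk1 : k 1 = a 1)
    (hhrec : ∀ i, h (i + 2) = a (i + 2) * h (i + 1) + h i)
    (hkrec : ∀ i, k (i + 2) = a (i + 2) * k (i + 1) + k i) (n : ℕ) :
    (k (n + 1) : ℝ) * β 0 - h (n + 1) = -β (n + 1) * (k n * β 0 - h n) := by
  induction n with
  | zero =>
    have := hβ 0
    rw [hβrec]
    simp only [zero_add, hh0, hk0, hh1, hk1]
    field_simp
    push_cast
    ring
  | succ n ih =>
    have h1 := hβ (n + 1)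
    have h2 : (k n * β 0 - h n : ℝ) = -(1 / β (n + 1)) * (k (n + 1) * β 0 - h (n + 1)) := by
      rw [ih]
      field_simp
    rw [hβrec (n + 1), hhrec, hkrec]
    push_cast
    linear_combination h2

theorem convergent_det {a h k : ℕ → ℕ}
    (hh0 : h 0 = 0) (hk0 : k 0 = 1) (hh1 : h 1 = 1)
    (hhrec : ∀ i, h (i + 2) = a (i + 2) * h (i + 1) + h i)
    (hkrec : ∀ i, k (i + 2) = a (i + 2) * k (i + 1) + k i) (n : ℕ) :
    (h (n + 1) : ℤ) * k n - h n * k (n + 1) = (-1) ^ n := by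
  induction n with
  | zero => simp [hh0, hk0, hh1]
  | succ n ih =>
    rw [hhrec, hkrec, pow_succ]
    push_cast
    linear_combination -ih

theorem convergent_error_even_pos {h k : ℕ → ℕ} {β : ℕ → ℝ} {γ : ℝ} (hβ : ∀ n, 0 < β n)
    (hγ : 0 < (k 0 : ℝ) * γ - h 0)
    (hsucc : ∀ n, (k (n + 1) : ℝ) * γ - h (n + 1) = -β (n + 1) * (k n * γ - h n)) (i : ℕ) :
    0 < (k (2 * i) : ℝ) * γ - h (2 * i) := by
  induction i with
  | zero => exact hγ
  | succ i ih =>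
    have h1 := mul_pos (mul_pos (hβ (2 * i + 1 + 1)) (hβ (2 * i + 1))) ih
    rw [show 2 * (i + 1) = 2 * i + 1 + 1 by ring, hsucc, hsucc]
    linarith

/-- If `(K, H)` and `(k, h)` form a unimodular pair of lattice points lying on opposite sides of
the line of slope `γ`, then no value `b * γ + c` with `b, c ≥ 0` lies strictly between
`r * γ + (H + s)` and `(r + K) * γ + s` when `r < k` and `s < h`. -/
theorem not_between_of_unimodular {γ : ℝ} {K H k h r s b c : ℕ}
    (hdet : (h : ℤ) * K - H * k = 1) (hA : 0 < (K : ℝ) * γ - H) (hB : (k : ℝ) * γ - h < 0)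
    (hr : r < k) (hs : s < h)
    (h1 : (r : ℝ) * γ + (H + s) < b * γ + c) (h2 : b * γ + c < ((r : ℝ) + K) * γ + s) :
    False := by
  obtain ⟨m, n, hx, hy⟩ : ∃ m n : ℤ, (b : ℤ) - r = m * K + n * k ∧
      (c : ℤ) - s - H = -(m * H + n * h) := by
    refine ⟨h * (b - r) + k * (c - s - H), -(H * (b - r) + K * (c - s - H)), ?_, ?_⟩
    · linear_combination -((b : ℤ) - r) * hdet
    · linear_combination -((c : ℤ) - s - H) * hdet
  have hxR : (b : ℝ) - r = m * K + n * k := by exact_mod_cast hx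
  have hyR : (c : ℝ) - s - H = -(m * H + n * h) := by exact_mod_cast hy
  have e1 : 0 < m * ((K : ℝ) * γ - H) + n * (k * γ - h) := by
    linear_combination h1 + γ * hxR + hyR
  have e2 : (m - 1) * ((K : ℝ) * γ - H) + n * (k * γ - h) < 0 := by
    linear_combination h2 - γ * hxR - hyR
  rcases le_or_gt m 0 with hm | hm
  · have hmR : (m : ℝ) ≤ 0 := by exact_mod_cast hm
    have hn : n < 0 := by
      by_contra! hn
      have hnR : (0 : ℝ) ≤ n := by exact_mod_cast hn
      nlinarith
    nlinarith
  · have hmR : (1 : ℝ) ≤ m := by exact_mod_cast hm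
    have hn : 0 < n := by
      by_contra! hn
      have hnR : (n : ℝ) ≤ 0 := by exact_mod_cast hn
      nlinarith
    nlinarith

/- Context: 1 < p1 < p2 naturals with γ = log p1 / log p2 irrational,
S = {p1^i * p2^j} the multiplicatively closed set generated by p1, p2,
γ = [0; a₁, a₂, …] its continued fraction (β i the tails), hᵢ/kᵢ its convergents. -/
theorem stmt_13 (p1 p2 : ℕ) (hp1 : 1 < p1) (hp12 : p1 < p2)
    (hγirr : Irrational (Real.log p1 / Real.log p2))
    (a h k : ℕ → ℕ) (β : ℕ → ℝ)
    (ha0 : a 0 = 0) (hapos : ∀ i, 1 ≤ i → 1 ≤ a i)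
    (hβ0 : β 0 = Real.log p1 / Real.log p2)
    (hfloor : ∀ i, (a (i + 1) : ℤ) = ⌊1 / β i⌋)
    (hβrec : ∀ i, β (i + 1) = 1 / β i - (a (i + 1) : ℝ))
    (hh0 : h 0 = 0) (hk0 : k 0 = 1) (hh1 : h 1 = 1) (hk1 : k 1 = a 1)
    (hhrec : ∀ i, h (i + 2) = a (i + 2) * h (i + 1) + h i)
    (hkrec : ∀ i, k (i + 2) = a (i + 2) * k (i + 1) + k i) :
    ∀ i t r s : ℕ, t < a (2 * i + 2) → r < k (2 * i + 1) → s < h (2 * i + 1) →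
      p1 ^ r * p2 ^ (h (2 * i) + t * h (2 * i + 1) + s)
          < p1 ^ (r + k (2 * i) + t * k (2 * i + 1)) * p2 ^ s ∧
      ∀ b c : ℕ,
        ¬(p1 ^ r * p2 ^ (h (2 * i) + t * h (2 * i + 1) + s) < p1 ^ b * p2 ^ c ∧
          p1 ^ b * p2 ^ c < p1 ^ (r + k (2 * i) + t * k (2 * i + 1)) * p2 ^ s) := by
  intro i t r s ht hr hs
  have hp1R : (1 : ℝ) < p1 := by exact_mod_cast hp1
  have hp2 : 1 < p2 := hp1.trans hp12
  have hp2R : (1 : ℝ) < p2 := by exact_mod_cast hp2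
  have hβ := irrational_and_pos_of_gauss_map (hβ0 ▸ hγirr)
    (hβ0 ▸ div_pos (Real.log_pos hp1R) (Real.log_pos hp2R)) hfloor hβrec
  have hsucc := convergent_error_succ (fun n => (hβ n).2.ne') hβrec hh0 hk0 hh1 hk1 hhrec hkrec
  have heven := convergent_error_even_pos (fun n => (hβ n).2)
    (by simpa [hh0, hk0] using (hβ 0).2) hsucc i
  have hodd : (k (2 * i + 1) : ℝ) * β 0 - h (2 * i + 1) < 0 := by
    rw [hsucc]
    have := mul_pos (hβ (2 * i + 1)).2 heven
    linarith
  have ht' : (t : ℝ) * β (2 * i + 1) < 1 := by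
    have h1 : ((a (2 * i + 1 + 1) : ℤ) : ℝ) ≤ 1 / β (2 * i + 1) := by
      rw [hfloor]
      exact Int.floor_le _
    have h2 : (t : ℝ) < a (2 * i + 1 + 1) := by exact_mod_cast ht
    push_cast at h1
    exact (lt_div_iff₀ (hβ (2 * i + 1)).2).mp (h2.trans_le h1)
  have hA : 0 < ((k (2 * i) + t * k (2 * i + 1) : ℕ) : ℝ) * β 0 -
      (h (2 * i) + t * h (2 * i + 1) : ℕ) := by
    have := mul_pos (sub_pos.mpr ht') heven
    push_cast
    linear_combination this - t * hsucc (2 * i)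
  have hdet : (h (2 * i + 1) : ℤ) * (k (2 * i) + t * k (2 * i + 1) : ℕ) -
      (h (2 * i) + t * h (2 * i + 1) : ℕ) * k (2 * i + 1) = 1 := by
    have := convergent_det hh0 hk0 hh1 hhrec hkrec (2 * i)
    rw [(even_two_mul i).neg_one_pow] at this
    push_cast
    linear_combination this
  simp only [pow_mul_pow_lt_iff_log_ratio hp1 hp2, ← hβ0, add_assoc r]
  refine ⟨?_, fun b c ⟨h1, h2⟩ =>
    not_between_of_unimodular (b := b) (c := c) hdet hA hodd hr hs ?_ ?_⟩
  · push_cast at hA ⊢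
    linarith
  · push_cast at h1 ⊢
    linarith
  · push_cast at h2 ⊢
    linarith
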